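/- Let C and D be finitely based permutation classes. Then the 2×2 grid class Grid(C,D; Av(21),Av(12)), whose top row is (C, D), whose bottom-left cell is increasing and whose bottom-right cell is decreasing, is finitely based. -/

import Mathlib

/-- A permutation of length `n`, given as a bijection of `Fin n`
(index/value `i` represents the entry `i+1` of `{1,…,n}`). -/
abbrev Perm' := Σ n : ℕ, Equiv.Perm (Fin n)

/-- `Contains σ π` means the pattern `σ` is contained in `π`. -/
def Contains (σ π : Perm') : Prop :=
  ∃ f : Fin σ.1 → Fin π.1, StrictMono f ∧
    ∀ i j : Fin σ.1, σ.2 i < σ.2 j ↔ π.2 (f i) < π.2 (f j)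

/-- A permutation class: a downward-closed set of permutations. -/
def IsPermClass (X : Set Perm') : Prop :=
  ∀ π ∈ X, ∀ σ : Perm', Contains σ π → σ ∈ X

/-- The avoidance set of a set `B` of permutations. -/
def Av (B : Set Perm') : Set Perm' := {π | ∀ β ∈ B, ¬ Contains β π}

/-- A set of permutations is finitely based if it is `Av B` for a finite `B`. -/
def FinitelyBased (X : Set Perm') : Prop := ∃ B : Set Perm', B.Finite ∧ X = Av B

/-- `PatternOn π S σ`: the entries of `π` at the set `S` of indices form a copy of `σ`. -/
def PatternOn (π : Perm') (S : Set (Fin π.1)) (σ : Perm') : Prop :=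
  ∃ f : Fin σ.1 → Fin π.1, StrictMono f ∧ Set.range f = S ∧
    ∀ i j : Fin σ.1, σ.2 i < σ.2 j ↔ π.2 (f i) < π.2 (f j)

/-- `PatternIn π S X`: the pattern of the entries of `π` at positions `S` lies in `X`. -/
def PatternIn (π : Perm') (S : Set (Fin π.1)) (X : Set Perm') : Prop :=
  ∃ σ ∈ X, PatternOn π S σ

/-- The permutation 21. -/
def perm21 : Perm' := ⟨2, Equiv.swap 0 1⟩
/-- The permutation 12. -/
def perm12 : Perm' := ⟨2, Equiv.refl (Fin 2)⟩
/-- The empty permutation. -/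
def emptyPerm : Perm' := ⟨0, Equiv.refl (Fin 0)⟩

/-- The 2×2 grid class `Grid(A,B;C,D)`: `A` top-left, `B` top-right, `C` bottom-left,
`D` bottom-right.  A position `i : Fin n` represents position `i+1`, so "position `≤ v`"
is `(i:ℕ) < v`, and "value `> h`" is `h ≤ (π.2 i : ℕ)`. -/
def GridClass (A B C D : Set Perm') : Set Perm' :=
  {π | ∃ v h : ℕ, v ≤ π.1 ∧ h ≤ π.1 ∧
    PatternIn π {i | (i : ℕ) < v ∧ h ≤ (π.2 i : ℕ)} A ∧
    PatternIn π {i | v ≤ (i : ℕ) ∧ h ≤ (π.2 i : ℕ)} B ∧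
    PatternIn π {i | (i : ℕ) < v ∧ (π.2 i : ℕ) < h} C ∧
    PatternIn π {i | v ≤ (i : ℕ) ∧ (π.2 i : ℕ) < h} D}

/-- Horizontal juxtaposition of `X` (left) and `Y` (right). -/
def HJuxt (X Y : Set Perm') : Set Perm' :=
  {π | ∃ v : ℕ, v ≤ π.1 ∧
    PatternIn π {i | (i : ℕ) < v} X ∧
    PatternIn π {i | v ≤ (i : ℕ)} Y}

/-- Vertical juxtaposition of `X` (top) and `Y` (bottom). -/
def VJuxt (X Y : Set Perm') : Set Perm' :=
  {π | ∃ h : ℕ, h ≤ π.1 ∧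
    PatternIn π {i | h ≤ (π.2 i : ℕ)} X ∧
    PatternIn π {i | (π.2 i : ℕ) < h} Y}

/-- `Squint≤(A,B;C,D)`: divisions `(v, ℓ, r)` with the left h-line `ℓ` no higher
than the right h-line `r`. -/
def SquintLE (A B C D : Set Perm') : Set Perm' :=
  {π | ∃ v l r : ℕ, v ≤ π.1 ∧ l ≤ π.1 ∧ r ≤ π.1 ∧ l ≤ r ∧
    PatternIn π {i | (i : ℕ) < v ∧ l ≤ (π.2 i : ℕ)} A ∧
    PatternIn π {i | (i : ℕ) < v ∧ (π.2 i : ℕ) < l} C ∧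
    PatternIn π {i | v ≤ (i : ℕ) ∧ r ≤ (π.2 i : ℕ)} B ∧
    PatternIn π {i | v ≤ (i : ℕ) ∧ (π.2 i : ℕ) < r} D}

/-- `Squint≥(A,B;C,D)`: divisions `(v, ℓ, r)` with the left h-line `ℓ` no lower
than the right h-line `r`. -/
def SquintGE (A B C D : Set Perm') : Set Perm' :=
  {π | ∃ v l r : ℕ, v ≤ π.1 ∧ l ≤ π.1 ∧ r ≤ π.1 ∧ r ≤ l ∧
    PatternIn π {i | (i : ℕ) < v ∧ l ≤ (π.2 i : ℕ)} A ∧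
    PatternIn π {i | (i : ℕ) < v ∧ (π.2 i : ℕ) < l} C ∧
    PatternIn π {i | v ≤ (i : ℕ) ∧ r ≤ (π.2 i : ℕ)} B ∧
    PatternIn π {i | v ≤ (i : ℕ) ∧ (π.2 i : ℕ) < r} D}

/-- The basis of a set `X`: minimal permutations not in `X`. -/
def PermBasis (X : Set Perm') : Set Perm' :=
  {π | π ∉ X ∧ ∀ σ : Perm', Contains σ π → σ ≠ π → σ ∈ X}

/-- `Occ B π P`: some `β ∈ B` occurs in `π` using only positions satisfying `P`. -/
def Occ (B : Set Perm') (π : Perm') (P : Fin π.1 → Prop) : Prop :=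
  ∃ β ∈ B, ∃ f : Fin β.1 → Fin π.1, StrictMono f ∧
    (∀ i j : Fin β.1, β.2 i < β.2 j ↔ π.2 (f i) < π.2 (f j)) ∧ ∀ i, P (f i)

lemma exists_pattern (π : Perm') (W : Finset (Fin π.1)) :
    ∃ σ : Perm', σ.1 = W.card ∧ PatternOn π (W : Set (Fin π.1)) σ := by
  classical
  set f : Fin W.card → Fin π.1 := fun i => W.orderEmbOfFin rfl i with hf
  have hfm : StrictMono f := (W.orderEmbOfFin rfl).strictMono
  set V : Finset (Fin π.1) := Finset.univ.image (fun i => π.2 (f i)) with hV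
  have hc : V.card = W.card := by
    exact (Finset.card_image_of_injective Finset.univ
      (π.2.injective.comp hfm.injective)).trans (by simp)
  let e := V.orderIsoOfFin hc
  let g : Fin W.card → Fin W.card := fun i => e.symm ⟨π.2 (f i), by simp [hV]⟩
  have hg : ∀ i j, g i < g j ↔ π.2 (f i) < π.2 (f j) := by
    intro i j
    simp only [g, OrderIso.lt_iff_lt, Subtype.mk_lt_mk]
  have hinj : Function.Injective g := by
    intro i j h
    have h2 := e.symm.injective h
    simp only [Subtype.mk.injEq] at h2
    exact hfm.injective (π.2.injective h2)
  refine ⟨⟨W.card, Equiv.ofBijective g (Finite.injective_iff_bijective.mp hinj)⟩, rfl,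
    f, hfm, ?_, ?_⟩
  · exact W.range_orderEmbOfFin rfl
  · intro i j
    exact (hg i j)

lemma occ_mono {B : Set Perm'} {π : Perm'} {P Q : Fin π.1 → Prop} (h : ∀ i, P i → Q i)
    (ho : Occ B π P) : Occ B π Q := by
  obtain ⟨β, hβ, f, h1, h2, h3⟩ := ho
  exact ⟨β, hβ, f, h1, h2, fun i => h _ (h3 i)⟩

/-- Occurrences push forward along containments. -/
lemma occ_push {B : Set Perm'} {σ π : Perm'} {f : Fin σ.1 → Fin π.1} (hf : StrictMono f)
    (ho : ∀ i j : Fin σ.1, σ.2 i < σ.2 j ↔ π.2 (f i) < π.2 (f j))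
    {P : Fin σ.1 → Prop} {Q : Fin π.1 → Prop} (h : ∀ i, P i → Q (f i))
    (hP : Occ B σ P) : Occ B π Q := by
  obtain ⟨β, hβ, g, h1, h2, h3⟩ := hP
  exact ⟨β, hβ, f ∘ g, hf.comp h1, fun i j => (h2 i j).trans (ho _ _), fun i => h _ (h3 i)⟩

/-- Occurrences inside the range of a containment pull back. -/
lemma occ_pull {B : Set Perm'} {σ π : Perm'} {f : Fin σ.1 → Fin π.1} (hf : StrictMono f)
    (ho : ∀ i j : Fin σ.1, σ.2 i < σ.2 j ↔ π.2 (f i) < π.2 (f j))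
    {P : Fin σ.1 → Prop} {Q : Fin π.1 → Prop} (h : ∀ i, Q (f i) → P i)
    (hQ : Occ B π (fun i => i ∈ Set.range f ∧ Q i)) : Occ B σ P := by
  obtain ⟨β, hβ, g, h1, h2, h3⟩ := hQ
  choose k hk using fun i => (h3 i).1
  refine ⟨β, hβ, k, ?_, ?_, ?_⟩
  · intro i j hij
    rw [← hf.lt_iff_lt, hk, hk]
    exact h1 hij
  · intro i j
    rw [ho, hk, hk, h2]
  · intro i
    apply h
    rw [hk]
    exact (h3 i).2

lemma patternIn_iff (π : Perm') (P : Fin π.1 → Prop) (B : Set Perm') :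
    PatternIn π {i | P i} (Av B) ↔ ¬ Occ B π P := by
  classical
  constructor
  · rintro ⟨σ, hσ, f, hf, hr, ho⟩ hocc
    have : Occ B σ (fun _ => True) := by
      refine occ_pull hf ho (Q := fun _ => True) (fun _ _ => trivial) ?_
      rw [hr]
      exact occ_mono (fun i hi => ⟨hi, trivial⟩) hocc
    obtain ⟨β, hβ, g, h1, h2, -⟩ := this
    exact hσ β hβ ⟨g, h1, h2⟩
  · intro hn
    obtain ⟨σ, -, hp⟩ := exists_pattern π (Finset.univ.filter P)
    refine ⟨σ, ?_, by simpa using hp⟩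
    obtain ⟨f, hf, hr, ho⟩ := hp
    rintro β hβ ⟨g, h1, h2⟩
    apply hn
    refine occ_push hf ho (P := fun _ => True) ?_ ⟨β, hβ, g, h1, h2, fun _ => trivial⟩
    intro i _
    have : f i ∈ Set.range f := ⟨i, rfl⟩
    rw [hr] at this
    simpa using this

lemma occ21 {π : Perm'} {P : Fin π.1 → Prop} :
    Occ {perm21} π P ↔ ∃ i j, i < j ∧ π.2 j < π.2 i ∧ P i ∧ P j := by
  constructor
  · rintro ⟨β, rfl, f, h1, h2, h3⟩
    refine ⟨f (0 : Fin 2), f (1 : Fin 2), h1 (by decide : (0 : Fin 2) < 1), ?_, h3 _, h3 _⟩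
    exact (h2 (1 : Fin 2) (0 : Fin 2)).1
      (by decide : Equiv.swap (0 : Fin 2) 1 1 < Equiv.swap (0 : Fin 2) 1 0)
  · rintro ⟨i, j, hij, hv, hi, hj⟩
    refine ⟨perm21, rfl, ![i, j], ?_, ?_, ?_⟩
    · intro a b hab
      change Fin 2 at a b
      fin_cases a <;> fin_cases b <;> first | exact absurd hab (by decide) | exact hij
    · intro a b
      change Fin 2 at a b
      fin_cases a <;> fin_cases b <;> first
        | exact iff_of_true (by decide :
            Equiv.swap (0 : Fin 2) 1 1 < Equiv.swap (0 : Fin 2) 1 0) hv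
        | exact iff_of_false (lt_irrefl _) (lt_irrefl _)
        | exact iff_of_false (by decide :
            ¬ Equiv.swap (0 : Fin 2) 1 0 < Equiv.swap (0 : Fin 2) 1 1) hv.asymm
    · intro a
      change Fin 2 at a
      fin_cases a <;> simp [hi, hj]

lemma occ12 {π : Perm'} {P : Fin π.1 → Prop} :
    Occ {perm12} π P ↔ ∃ i j, i < j ∧ π.2 i < π.2 j ∧ P i ∧ P j := by
  constructor
  · rintro ⟨β, rfl, f, h1, h2, h3⟩
    refine ⟨f (0 : Fin 2), f (1 : Fin 2), h1 (by decide : (0 : Fin 2) < 1), ?_, h3 _, h3 _⟩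
    exact (h2 (0 : Fin 2) (1 : Fin 2)).1 (by decide : (0 : Fin 2) < 1)
  · rintro ⟨i, j, hij, hv, hi, hj⟩
    refine ⟨perm12, rfl, ![i, j], ?_, ?_, ?_⟩
    · intro a b hab
      change Fin 2 at a b
      fin_cases a <;> fin_cases b <;> first | exact absurd hab (by decide) | exact hij
    · intro a b
      change Fin 2 at a b
      fin_cases a <;> fin_cases b <;> first
        | exact iff_of_true (by decide : (0 : Fin 2) < 1) hv
        | exact iff_of_false (lt_irrefl _) (lt_irrefl _)
        | exact iff_of_false (by decide : ¬ (1 : Fin 2) < 0) hv.asymm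
    · intro a
      change Fin 2 at a
      fin_cases a <;> simp [hi, hj]

/-- The division `(v, h)` of `π` is obstructed, using only positions in `W`. -/
def Bad (E F : Set Perm') (π : Perm') (W : Set (Fin π.1)) (v h : ℕ) : Prop :=
  Occ E π (fun i => i ∈ W ∧ (i : ℕ) < v ∧ h ≤ (π.2 i : ℕ)) ∨
  Occ F π (fun i => i ∈ W ∧ v ≤ (i : ℕ) ∧ h ≤ (π.2 i : ℕ)) ∨
  Occ {perm21} π (fun i => i ∈ W ∧ (i : ℕ) < v ∧ (π.2 i : ℕ) < h) ∨
  Occ {perm12} π (fun i => i ∈ W ∧ v ≤ (i : ℕ) ∧ (π.2 i : ℕ) < h)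

lemma mem_grid_iff (E F : Set Perm') (π : Perm') :
    π ∈ GridClass (Av E) (Av F) (Av {perm21}) (Av {perm12}) ↔
      ∃ v h : ℕ, v ≤ π.1 ∧ h ≤ π.1 ∧ ¬ Bad E F π Set.univ v h := by
  simp only [GridClass, Set.mem_ofPred_eq, patternIn_iff, Bad, not_or, Set.mem_univ, true_and]

lemma bad_mono {E F : Set Perm'} {π : Perm'} {W W' : Set (Fin π.1)} (hW : W ⊆ W') {v h : ℕ}
    (hb : Bad E F π W v h) : Bad E F π W' v h := by
  rcases hb with hb | hb | hb | hb
  · exact Or.inl (occ_mono (fun i hi => ⟨hW hi.1, hi.2⟩) hb)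
  · exact Or.inr (Or.inl (occ_mono (fun i hi => ⟨hW hi.1, hi.2⟩) hb))
  · exact Or.inr (Or.inr (Or.inl (occ_mono (fun i hi => ⟨hW hi.1, hi.2⟩) hb)))
  · exact Or.inr (Or.inr (Or.inr (occ_mono (fun i hi => ⟨hW hi.1, hi.2⟩) hb)))

/-- Transfer of a cut line between two order-isomorphic value lists. -/
lemma exists_cut {k n : ℕ} (g g' : Fin k → ℕ) (hg : ∀ i j, g i < g j ↔ g' i < g' j)
    (hn : ∀ i, g' i < n) (h : ℕ) : ∃ h' ≤ n, ∀ a, g a < h ↔ g' a < h' := by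
  classical
  refine ⟨(Finset.univ.filter (fun a => g a < h)).sup (fun a => g' a + 1), ?_, ?_⟩
  · exact Finset.sup_le fun a _ => hn a
  · intro a
    rw [Finset.lt_sup_iff]
    constructor
    · intro ha
      exact ⟨a, by simpa using ha, by omega⟩
    · rintro ⟨b, hb, hab⟩
      have h1 : g b < h := by simpa using hb
      have h2 := hg b a
      omega

lemma grid_down (E F : Set Perm') {σ π : Perm'} (hc : Contains σ π)
    (hπ : π ∈ GridClass (Av E) (Av F) (Av {perm21}) (Av {perm12})) :
    σ ∈ GridClass (Av E) (Av F) (Av {perm21}) (Av {perm12}) := by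
  rw [mem_grid_iff] at hπ ⊢
  obtain ⟨v, h, -, -, hb⟩ := hπ
  obtain ⟨f, hf, ho⟩ := hc
  obtain ⟨v', hv', hv⟩ := exists_cut (n := σ.1) (fun i => (f i : ℕ)) (fun i => (i : ℕ))
    (fun i j => hf.lt_iff_lt) (fun i => i.2) v
  obtain ⟨h', hh', hh⟩ := exists_cut (n := σ.1) (fun i => (π.2 (f i) : ℕ))
    (fun i => (σ.2 i : ℕ)) (fun i j => (ho i j).symm) (fun i => (σ.2 i).2) h
  refine ⟨v', h', hv', hh', fun hb' => hb ?_⟩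
  simp only [Bad, ← not_lt, ← hv, ← hh, Set.mem_univ, true_and] at hb' ⊢
  rcases hb' with hb | hb | hb | hb
  · exact Or.inl (occ_push hf ho (fun i hi => hi) hb)
  · exact Or.inr (Or.inl (occ_push hf ho (fun i hi => hi) hb))
  · exact Or.inr (Or.inr (Or.inl (occ_push hf ho (fun i hi => hi) hb)))
  · exact Or.inr (Or.inr (Or.inr (occ_push hf ho (fun i hi => hi) hb)))

lemma not_grid_of_bad (E F : Set Perm') {σ π : Perm'} {W : Set (Fin π.1)}
    (hp : PatternOn π W σ) (hW : ∀ v h, v ≤ π.1 → h ≤ π.1 → Bad E F π W v h) :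
    σ ∉ GridClass (Av E) (Av F) (Av {perm21}) (Av {perm12}) := by
  rw [mem_grid_iff]
  rintro ⟨v, h, -, -, hb⟩
  obtain ⟨f, hf, rfl, ho⟩ := hp
  obtain ⟨v', hv', hv⟩ := exists_cut (n := π.1) (fun i => (i : ℕ)) (fun i => (f i : ℕ))
    (fun i j => hf.lt_iff_lt.symm) (fun i => (f i).2) v
  obtain ⟨h', hh', hh⟩ := exists_cut (n := π.1) (fun i => (σ.2 i : ℕ))
    (fun i => (π.2 (f i) : ℕ)) (fun i j => ho i j) (fun i => (π.2 (f i)).2) h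
  apply hb
  have hb' := hW v' h' hv' hh'
  simp only [Bad, ← not_lt, hv, hh, Set.mem_univ, true_and] at hb' ⊢
  rcases hb' with hb | hb | hb | hb
  · exact Or.inl (occ_pull hf ho (fun i hi => hi) hb)
  · exact Or.inr (Or.inl (occ_pull hf ho (fun i hi => hi) hb))
  · exact Or.inr (Or.inr (Or.inl (occ_pull hf ho (fun i hi => hi) hb)))
  · exact Or.inr (Or.inr (Or.inr (occ_pull hf ho (fun i hi => hi) hb)))

lemma occ_finset {B : Set Perm'} {π : Perm'} {M : ℕ} (hM : ∀ β ∈ B, β.1 ≤ M)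
    {P : Fin π.1 → Prop} (ho : Occ B π P) :
    ∃ S : Finset (Fin π.1), S.card ≤ M ∧ (∀ i ∈ S, P i) ∧
      ∀ Q : Fin π.1 → Prop, (∀ i ∈ S, Q i) → Occ B π Q := by
  classical
  obtain ⟨β, hβ, f, h1, h2, h3⟩ := ho
  refine ⟨Finset.univ.image f, ?_, ?_, ?_⟩
  · exact Finset.card_image_le.trans (by simpa using hM β hβ)
  · intro i hi
    obtain ⟨a, -, rfl⟩ := Finset.mem_image.1 hi
    exact h3 a
  · intro Q hQ
    exact ⟨β, hβ, f, h1, h2, fun i => hQ _ (Finset.mem_image_of_mem f (Finset.mem_univ i))⟩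

/-- Key step: each vertical line `v` yields a small set of entries obstructing all divisions
on one side of it. -/
lemma key {E F : Set Perm'} {π : Perm'} {M : ℕ} (hE : ∀ β ∈ E, β.1 ≤ M)
    (hF : ∀ β ∈ F, β.1 ≤ M) (v : ℕ) (hb : ∀ h ≤ π.1, Bad E F π Set.univ v h) :
    ∃ W : Finset (Fin π.1), W.card ≤ M + 2 ∧
      ((∀ v' ≤ v, ∀ h', Bad E F π W v' h') ∨ (∀ v' ≥ v, ∀ h', Bad E F π W v' h')) := by
  classical
  -- a lower obstruction which is empty obstructs everything
  have hlow : ∃ S : Finset (Fin π.1), ∃ h : ℕ, S.card ≤ M ∧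
      (((∀ i ∈ S, (i : ℕ) < v ∧ h ≤ (π.2 i : ℕ)) ∧
          ∀ Q : Fin π.1 → Prop, (∀ i ∈ S, Q i) → Occ E π Q) ∨
       ((∀ i ∈ S, v ≤ (i : ℕ) ∧ h ≤ (π.2 i : ℕ)) ∧
          ∀ Q : Fin π.1 → Prop, (∀ i ∈ S, Q i) → Occ F π Q)) ∧
      (S = ∅ ∨ ∃ i j : Fin π.1, i < j ∧
        ((π.2 j < π.2 i ∧ (j : ℕ) < v ∧ (π.2 i : ℕ) ≤ h) ∨
         (π.2 i < π.2 j ∧ v ≤ (i : ℕ) ∧ (π.2 j : ℕ) ≤ h))) := by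
    let L : ℕ → Prop := fun h =>
      Occ E π (fun i => (i : ℕ) < v ∧ h ≤ (π.2 i : ℕ)) ∨
      Occ F π (fun i => v ≤ (i : ℕ) ∧ h ≤ (π.2 i : ℕ))
    have hL : ∃ h, L h ∧ (h = π.1 ∨ (h < π.1 ∧ ¬ L (h + 1))) := by
      have h0 : L 0 := by
        have := hb 0 (Nat.zero_le _)
        simpa [Bad, occ12, occ21, L] using this
      by_contra hcon
      push Not at hcon
      have : ∀ h, h ≤ π.1 → L h := by
        intro h
        induction h with
        | zero => exact fun _ => h0
        | succ k ih =>
          intro hk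
          exact (hcon k (ih (by omega))).2 (by omega)
      exact (hcon π.1 (this _ le_rfl)).1 rfl
    obtain ⟨h, hLh, hh⟩ := hL
    have hT : h = π.1 ∨ ∃ i j : Fin π.1, i < j ∧
        ((π.2 j < π.2 i ∧ (j : ℕ) < v ∧ (π.2 i : ℕ) ≤ h) ∨
         (π.2 i < π.2 j ∧ v ≤ (i : ℕ) ∧ (π.2 j : ℕ) ≤ h)) := by
      rcases hh with hh | ⟨hlt, hnL⟩
      · exact Or.inl hh
      · right
        rcases hb (h + 1) (by omega) with hb | hb | hb | hb
        · exact absurd (Or.inl (occ_mono (fun i hi => hi.2) hb)) hnL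
        · exact absurd (Or.inr (occ_mono (fun i hi => hi.2) hb)) hnL
        · obtain ⟨i, j, hij, hv, hi, hj⟩ := occ21.1 hb
          exact ⟨i, j, hij, Or.inl ⟨hv, hj.2.1, Nat.lt_succ_iff.1 hi.2.2⟩⟩
        · obtain ⟨i, j, hij, hv, hi, hj⟩ := occ12.1 hb
          exact ⟨i, j, hij, Or.inr ⟨hv, hi.2.1, Nat.lt_succ_iff.1 hj.2.2⟩⟩
    have hempty : ∀ S : Finset (Fin π.1), (∀ i ∈ S, h ≤ (π.2 i : ℕ)) → h = π.1 → S = ∅ := by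
      intro S hS hh
      rw [Finset.eq_empty_iff_forall_notMem]
      intro i hi
      have := hS i hi
      have := (π.2 i).2
      omega
    rcases hLh with hLh | hLh
    · obtain ⟨S, hc, hS, hocc⟩ := occ_finset hE hLh
      exact ⟨S, h, hc, Or.inl ⟨hS, hocc⟩, hT.imp_left (hempty S fun i hi => (hS i hi).2)⟩
    · obtain ⟨S, hc, hS, hocc⟩ := occ_finset hF hLh
      exact ⟨S, h, hc, Or.inr ⟨hS, hocc⟩, hT.imp_left (hempty S fun i hi => (hS i hi).2)⟩
  obtain ⟨S, h, hc, hS, hT⟩ := hlow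
  by_cases hne : S = ∅
  · refine ⟨S, by omega, Or.inl fun v' _ h' => ?_⟩
    subst hne
    rcases hS with ⟨-, hS⟩ | ⟨-, hS⟩
    · exact Or.inl (hS _ (by simp))
    · exact Or.inr (Or.inl (hS _ (by simp)))
  obtain ⟨i, j, hij, hT⟩ := hT.resolve_left hne
  obtain ⟨q, hqS, hq⟩ := Finset.exists_min_image S (fun a => (π.2 a : ℕ))
    (Finset.nonempty_iff_ne_empty.2 hne)
  refine ⟨S ∪ {i, j}, (Finset.card_union_le _ _).trans
    (Nat.add_le_add hc Finset.card_le_two), ?_⟩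
  have hiW : i ∈ ((S ∪ {i, j} : Finset (Fin π.1)) : Set (Fin π.1)) := by simp
  have hjW : j ∈ ((S ∪ {i, j} : Finset (Fin π.1)) : Set (Fin π.1)) := by simp
  have hSW : ∀ a ∈ S, a ∈ ((S ∪ {i, j} : Finset (Fin π.1)) : Set (Fin π.1)) := by
    intro a ha
    simp [ha]
  generalize ((S ∪ {i, j} : Finset (Fin π.1)) : Set (Fin π.1)) = W at hiW hjW hSW
  have hijn : (i : ℕ) < j := hij
  rcases hS with ⟨hS, hocc⟩ | ⟨hS, hocc⟩
  · -- lower obstruction on the left: everything to the right of `v` is obstructed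
    right
    intro v' hv' h'
    have hqv := hS q hqS
    by_cases hlo : h' ≤ (π.2 q : ℕ)
    · exact Or.inl (hocc _ fun a ha => ⟨hSW a ha, (hS a ha).1.trans_le hv', hlo.trans (hq a ha)⟩)
    · rcases hT with ⟨hv, hjv, hih⟩ | ⟨hv, hiv, hjh⟩
      · have hvn : (π.2 j : ℕ) < π.2 i := hv
        refine Or.inr (Or.inr (Or.inl (occ21.2 ⟨i, j, hij, hv, ⟨hiW, ?_, ?_⟩, hjW, ?_, ?_⟩))) <;>
          omega
      · have hvn : (π.2 i : ℕ) < π.2 j := hv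
        by_cases hvi : (i : ℕ) < v'
        · refine Or.inr (Or.inr (Or.inl (occ21.2 ⟨q, i, ?_, ?_, ⟨hSW q hqS, ?_, ?_⟩,
            hiW, ?_, ?_⟩))) <;> (try rw [Fin.lt_def]) <;> omega
        · refine Or.inr (Or.inr (Or.inr (occ12.2 ⟨i, j, hij, hv, ⟨hiW, ?_, ?_⟩, hjW, ?_, ?_⟩))) <;>
            omega
  · left
    intro v' hv' h'
    have hqv := hS q hqS
    by_cases hlo : h' ≤ (π.2 q : ℕ)
    · exact Or.inr (Or.inl (hocc _ fun a ha =>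
        ⟨hSW a ha, hv'.trans (hS a ha).1, hlo.trans (hq a ha)⟩))
    · rcases hT with ⟨hv, hjv, hih⟩ | ⟨hv, hiv, hjh⟩
      · have hvn : (π.2 j : ℕ) < π.2 i := hv
        by_cases hvj : (j : ℕ) < v'
        · refine Or.inr (Or.inr (Or.inl (occ21.2 ⟨i, j, hij, hv, ⟨hiW, ?_, ?_⟩, hjW, ?_, ?_⟩))) <;>
            omega
        · refine Or.inr (Or.inr (Or.inr (occ12.2 ⟨j, q, ?_, ?_, ⟨hjW, ?_, ?_⟩,
            hSW q hqS, ?_, ?_⟩))) <;> (try rw [Fin.lt_def]) <;> omega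
      · have hvn : (π.2 i : ℕ) < π.2 j := hv
        refine Or.inr (Or.inr (Or.inr (occ12.2 ⟨i, j, hij, hv, ⟨hiW, ?_, ?_⟩, hjW, ?_, ?_⟩))) <;>
          omega

/-- A permutation outside the grid class has a small non-griddable set of entries. -/
lemma exists_small {E F : Set Perm'} {π : Perm'} {M : ℕ} (hE : ∀ β ∈ E, β.1 ≤ M)
    (hF : ∀ β ∈ F, β.1 ≤ M)
    (hb : ∀ v h, v ≤ π.1 → h ≤ π.1 → Bad E F π Set.univ v h) :
    ∃ W : Finset (Fin π.1), W.card ≤ 2 * M + 4 ∧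
      ∀ v h, v ≤ π.1 → h ≤ π.1 → Bad E F π W v h := by
  classical
  let R : ℕ → Prop := fun v => ∃ W : Finset (Fin π.1), W.card ≤ M + 2 ∧
    ∀ v' ≤ v, ∀ h', Bad E F π W v' h'
  by_cases hR : R π.1
  · obtain ⟨W, hc, hW⟩ := hR
    exact ⟨W, by omega, fun v h hv _ => hW v hv h⟩
  have hex : ∃ v, v ≤ π.1 ∧ ¬ R v := ⟨_, le_rfl, hR⟩
  have hspec := Nat.find_spec hex
  have hmin := fun m => Nat.find_min hex (m := m)
  generalize Nat.find hex = v at hspec hmin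
  obtain ⟨hv, hnR⟩ := hspec
  obtain ⟨W, hc, hW⟩ := key hE hF v (fun h hh => hb v h hv hh)
  have hW2 := hW.resolve_left (fun h => hnR ⟨W, hc, h⟩)
  rcases Nat.eq_zero_or_pos v with rfl | hpos
  · exact ⟨W, by omega, fun v h _ _ => hW2 v (Nat.zero_le _) h⟩
  · have : R (v - 1) := by
      by_contra hx
      exact hmin (v - 1) (by omega) ⟨by omega, hx⟩
    obtain ⟨W', hc', hW'⟩ := this
    refine ⟨W ∪ W', (Finset.card_union_le _ _).trans (by omega), ?_⟩
    intro a h _ _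
    by_cases hav : v ≤ a
    · exact bad_mono (by simp) (hW2 a hav h)
    · exact bad_mono (by simp) (hW' a (by omega) h)

lemma finite_bounded (N : ℕ) : {σ : Perm' | σ.1 ≤ N}.Finite := by
  have : {σ : Perm' | σ.1 ≤ N} =
      ⋃ n ∈ Set.Iic N, Set.range (fun p : Equiv.Perm (Fin n) => (⟨n, p⟩ : Perm')) := by
    ext ⟨n, p⟩
    simp only [Set.mem_ofPred_eq, Set.mem_iUnion, Set.mem_Iic, Set.mem_range, exists_prop]
    constructor
    · intro h
      exact ⟨n, h, p, rfl⟩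
    · rintro ⟨m, hm, q, hq⟩
      cases hq
      exact hm
  rw [this]
  exact (Set.finite_Iic N).biUnion fun n _ => Set.finite_range _

lemma exists_bound {B : Set Perm'} (hB : B.Finite) : ∃ M, ∀ β ∈ B, β.1 ≤ M := by
  obtain ⟨M, hM⟩ := (hB.image (fun β => β.1)).bddAbove
  exact ⟨M, fun β hβ => hM ⟨β, hβ, rfl⟩⟩

/-- For finitely based permutation classes `C`, `D`, the grid class
`Grid(C,D;Av 21,Av 12)` is finitely based. -/
theorem grid2x2_incr_decr_finitelyBased (C D : Set Perm')
    (hC : IsPermClass C) (hD : IsPermClass D)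
    (hCfb : FinitelyBased C) (hDfb : FinitelyBased D) :
    FinitelyBased (GridClass C D (Av {perm21}) (Av {perm12})) := by
  obtain ⟨E, hEf, rfl⟩ := hCfb
  obtain ⟨F, hFf, rfl⟩ := hDfb
  obtain ⟨M₁, hM₁⟩ := exists_bound hEf
  obtain ⟨M₂, hM₂⟩ := exists_bound hFf
  set G := GridClass (Av E) (Av F) (Av {perm21}) (Av {perm12}) with hG
  set N := 2 * max M₁ M₂ + 4 with hN
  refine ⟨{σ | σ.1 ≤ N ∧ σ ∉ G}, (finite_bounded N).subset fun σ hσ => hσ.1, ?_⟩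
  ext π
  constructor
  · rintro hπ β ⟨-, hβ⟩ hc
    exact hβ (grid_down E F hc hπ)
  · intro hπ
    by_contra hn
    rw [hG, mem_grid_iff] at hn
    push Not at hn
    obtain ⟨W, hc, hW⟩ := exists_small (M := max M₁ M₂)
      (fun β hβ => (hM₁ β hβ).trans (le_max_left _ _))
      (fun β hβ => (hM₂ β hβ).trans (le_max_right _ _)) hn
    obtain ⟨σ, hσ, hp⟩ := exists_pattern π W
    have hns := not_grid_of_bad E F hp hW
    obtain ⟨f, hf, -, ho⟩ := hp
    exact hπ σ ⟨by omega, hns⟩ ⟨f, hf, ho⟩
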